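/- For each even integer r ≥ 4, the alternating group A_{2r+1} has a string C-group representation of rank r with Schläfli type {10, 3^{r−2}}, i.e. with p_1 = 10 and p_i = 3 for 2 ≤ i ≤ r−1. For each odd integer q ≥ 5, the alternating group A_{2q+3} has a string C-group representation of rank q with Schläfli type {10, 3^{q−4}, 6, 4}, i.e. with p_1 = 10, p_i = 3 for 2 ≤ i ≤ q−3, p_{q−2} = 6 and p_{q−1} = 4. In particular, for each rank k ≥ 3 there is a string C-group representation of rank k whose group is A_n for some n. -/

import Mathlib

/-- A string C-group representation of rank `n` of a group `G`: a family of `n`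
involutions generating `G`, satisfying the commuting (string) property and the
intersection property. -/
def IsStringCGroupRep {G : Type*} [Group G] {n : ℕ} (ρ : Fin n → G) : Prop :=
  (∀ i, orderOf (ρ i) = 2) ∧
  Subgroup.closure (Set.range ρ) = ⊤ ∧
  (∀ i j : Fin n, i.val + 1 < j.val → Commute (ρ i) (ρ j)) ∧
  (∀ I J : Set (Fin n),
    Subgroup.closure (ρ '' I) ⊓ Subgroup.closure (ρ '' J) = Subgroup.closure (ρ '' (I ∩ J)))

section

open Equiv Equiv.Perm

/-- A family of elements satisfying the string property has the intersection property as soon as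
each `⟨ρ i : i ≠ 0, i ∈ J⟩` can be cut out inside `⟨ρ i : i ≠ 0⟩` by subgroups `Q k`, `k ∉ J`,
where `Q k` contains all `ρ j` with `j ≠ k`. -/
theorem intersection_property_of_separating {G : Type*} [Group G] {n : ℕ} {ρ : Fin (n + 1) → G}
    (hcomm : ∀ i j : Fin (n + 1), i.val + 1 < j.val → Commute (ρ i) (ρ j))
    (Q : Fin (n + 1) → Subgroup G) (hQ : ∀ j k, j ≠ k → ρ j ∈ Q k)
    (hsep : ∀ J : Set (Fin (n + 1)), 0 ∉ J → ∀ g ∈ Subgroup.closure (ρ '' {0}ᶜ),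
      (∀ k ∉ J, k ≠ 0 → g ∈ Q k) → g ∈ Subgroup.closure (ρ '' J))
    (I J : Set (Fin (n + 1))) :
    Subgroup.closure (ρ '' I) ⊓ Subgroup.closure (ρ '' J) = Subgroup.closure (ρ '' (I ∩ J)) := by
  have mono : ∀ {A B : Set (Fin (n + 1))}, A ⊆ B →
      Subgroup.closure (ρ '' A) ≤ Subgroup.closure (ρ '' B) := fun h =>
    Subgroup.closure_mono (Set.image_mono h)
  have leQ : ∀ (A : Set (Fin (n + 1))) (k), k ∉ A → Subgroup.closure (ρ '' A) ≤ Q k := by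
    intro A k hk
    rw [Subgroup.closure_le]
    rintro _ ⟨j, hj, rfl⟩
    exact hQ j k fun h => hk (h ▸ hj)
  refine le_antisymm ?_ (le_inf (mono Set.inter_subset_left) (mono Set.inter_subset_right))
  by_cases huniv : ∀ k, k ∈ I ∩ J
  · have hI : I ∩ J = Set.univ := Set.eq_univ_of_forall huniv
    rw [hI]
    exact inf_le_left.trans (mono (Set.subset_univ _))
  have hex : ∃ k : ℕ, ∃ h : k < n + 1, (⟨k, h⟩ : Fin (n + 1)) ∉ I ∩ J := by
    push Not at huniv
    obtain ⟨k, hk⟩ := huniv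
    exact ⟨k, k.2, hk⟩
  classical
  obtain ⟨hk, hkIJ⟩ := Nat.find_spec hex
  have hmin : ∀ j : Fin (n + 1), j.val < Nat.find hex → j ∈ I ∩ J := fun j hj => by
    by_contra h
    exact Nat.find_min hex hj ⟨j.2, h⟩
  generalize Nat.find hex = k at hk hkIJ hmin
  clear huniv hex
  wlog hkI : (⟨k, hk⟩ : Fin (n + 1)) ∉ I generalizing I J
  · have hkJ : (⟨k, hk⟩ : Fin (n + 1)) ∉ J := fun h => hkIJ ⟨not_not.mp hkI, h⟩
    rw [inf_comm, Set.inter_comm]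
    rw [Set.inter_comm] at hkIJ hmin
    exact this J I hkIJ hmin hkJ
  rintro g ⟨hgI, hgJ⟩
  set A : Set (Fin (n + 1)) := {j | j.val < k}
  set B : Set (Fin (n + 1)) := {j | j ∈ I ∧ k < j.val}
  have hAB : ∀ a ∈ Subgroup.closure (ρ '' A), ∀ b ∈ Subgroup.closure (ρ '' B), Commute a b := by
    have hAB' : Subgroup.closure (ρ '' A) ≤
        Subgroup.centralizer (Subgroup.closure (ρ '' B) : Set G) := by
      rw [Subgroup.closure_le, Subgroup.centralizer_closure]
      rintro _ ⟨i, hi, rfl⟩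
      rw [SetLike.mem_coe, Subgroup.mem_centralizer_iff]
      rintro _ ⟨j, hj, rfl⟩
      have h1 : i.val < k := hi
      have h2 : k < j.val := hj.2
      exact (hcomm i j (by omega)).eq.symm
    exact fun a ha b hb => (Subgroup.mem_centralizer_iff.mp (hAB' ha) b hb).symm
  obtain ⟨a, ha, b, hb, rfl⟩ : ∃ a ∈ Subgroup.closure (ρ '' A),
      ∃ b ∈ Subgroup.closure (ρ '' B), a * b = g := by
    clear hgJ
    induction hgI using Subgroup.closure_induction with
    | mem x hx =>
      obtain ⟨i, hi, rfl⟩ := hx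
      rcases lt_trichotomy i.val k with h | h | h
      · exact ⟨ρ i, Subgroup.subset_closure ⟨i, h, rfl⟩, 1, one_mem _, mul_one _⟩
      · subst h; exact absurd hi hkI
      · exact ⟨1, one_mem _, ρ i, Subgroup.subset_closure ⟨i, ⟨hi, h⟩, rfl⟩, one_mul _⟩
    | one => exact ⟨1, one_mem _, 1, one_mem _, one_mul _⟩
    | mul x y _ _ hx hy =>
      obtain ⟨a, ha, b, hb, rfl⟩ := hx
      obtain ⟨c, hc, d, hd, rfl⟩ := hy
      refine ⟨a * c, mul_mem ha hc, b * d, mul_mem hb hd, ?_⟩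
      rw [mul_assoc, ← mul_assoc c, (hAB c hc b hb).eq]
      group
    | inv x _ hx =>
      obtain ⟨a, ha, b, hb, rfl⟩ := hx
      refine ⟨a⁻¹, inv_mem ha, b⁻¹, inv_mem hb, ?_⟩
      rw [mul_inv_rev, ((hAB a ha b hb).inv_inv).eq]
  have haIJ : a ∈ Subgroup.closure (ρ '' (I ∩ J)) := mono hmin ha
  have hbI : b ∈ Subgroup.closure (ρ '' I) := mono (fun j hj => hj.1) hb
  have hbJ : b ∈ Subgroup.closure (ρ '' J) :=
    (Subgroup.mul_mem_cancel_left _ (mono Set.inter_subset_right haIJ)).mp hgJ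
  have hbT : b ∈ Subgroup.closure (ρ '' {0}ᶜ) := by
    refine mono (Set.subset_compl_singleton_iff.mpr fun h => ?_) hb
    exact Nat.not_lt_zero k h.2
  refine mul_mem haIJ (mono (Set.sdiff_subset (t := {0}))
    (hsep _ (fun h => h.2 rfl) b hbT fun l hl hl0 => ?_))
  by_cases hlI : l ∈ I
  · exact leQ J l (fun hlJ => hl ⟨⟨hlI, hlJ⟩, hl0⟩) hbJ
  · exact leQ I l hlI hbI

theorem isStringCGroupRep_of_injective {G H : Type*} [Group G] [Group H] {n : ℕ} (ψ : G →* H)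
    (hψ : Function.Injective ψ) {ρ : Fin n → G} {σ : Fin n → H} (hρ : ∀ i, ψ (ρ i) = σ i)
    (hord : ∀ i, orderOf (σ i) = 2) (hgen : Subgroup.closure (Set.range σ) = ψ.range)
    (hcomm : ∀ i j : Fin n, i.val + 1 < j.val → Commute (σ i) (σ j))
    (hint : ∀ I J : Set (Fin n),
      Subgroup.closure (σ '' I) ⊓ Subgroup.closure (σ '' J) = Subgroup.closure (σ '' (I ∩ J))) :
    IsStringCGroupRep ρ := by
  obtain rfl : ψ ∘ ρ = σ := funext hρ
  have hmap : ∀ I : Set (Fin n),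
      (Subgroup.closure (ρ '' I)).map ψ = Subgroup.closure ((ψ ∘ ρ) '' I) := fun I => by
    rw [MonoidHom.map_closure, Set.image_comp]
  refine ⟨fun i => ?_, ?_, fun i j hij => ?_, fun I J => ?_⟩
  · rw [← hord i]
    exact (orderOf_injective ψ hψ _).symm
  · apply Subgroup.map_injective hψ
    rw [MonoidHom.map_closure, ← Set.range_comp, hgen, MonoidHom.range_eq_map]
  · apply hψ
    simpa using (hcomm i j hij).eq
  · apply Subgroup.map_injective hψ
    rw [Subgroup.map_inf _ _ _ hψ, hmap, hmap, hmap, hint]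

/-- Transport of a string C-group inside `Perm V` generating the alternating group to
`alternatingGroup (Fin N)`. -/
theorem exists_isStringCGroupRep_alternatingGroup {V : Type*} [Fintype V] [DecidableEq V] {N n : ℕ}
    (e : V ≃ Fin N) {σ : Fin n → Perm V} (hord : ∀ i, orderOf (σ i) = 2)
    (hgen : Subgroup.closure (Set.range σ) = alternatingGroup V)
    (hcomm : ∀ i j : Fin n, i.val + 1 < j.val → Commute (σ i) (σ j))
    (hint : ∀ I J : Set (Fin n),
      Subgroup.closure (σ '' I) ⊓ Subgroup.closure (σ '' J) = Subgroup.closure (σ '' (I ∩ J))) :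
    ∃ ρ : Fin n → alternatingGroup (Fin N), IsStringCGroupRep ρ ∧
      ∀ i j, orderOf (ρ i * ρ j) = orderOf (σ i * σ j) := by
  have hmem : ∀ i, σ i ∈ alternatingGroup V := fun i =>
    hgen ▸ Subgroup.subset_closure (Set.mem_range_self i)
  set ψ : alternatingGroup (Fin N) →* Perm V :=
    (alternatingGroup V).subtype.comp e.altCongrHom.symm.toMonoidHom
  have hψ : Function.Injective ψ :=
    (Subgroup.subtype_injective _).comp e.altCongrHom.symm.injective
  have hρ : ∀ i, ψ (e.altCongrHom ⟨σ i, hmem i⟩) = σ i := fun i => by simp [ψ]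
  refine ⟨fun i => e.altCongrHom ⟨σ i, hmem i⟩,
    isStringCGroupRep_of_injective ψ hψ hρ hord ?_ hcomm hint, fun i j => ?_⟩
  · rw [hgen, MonoidHom.range_comp, MonoidHom.range_eq_top.mpr e.altCongrHom.symm.surjective,
      ← MonoidHom.range_eq_map, Subgroup.range_subtype]
  · rw [← orderOf_injective ψ hψ, map_mul, hρ, hρ]

theorem mem_of_forall_swap_mem {α : Type*} [Finite α] [DecidableEq α] {H : Subgroup (Perm α)}
    {f : Perm α} (h : ∀ x, swap x (f x) ∈ H) : f ∈ H := by
  set S : Set (Perm α) := {g | g ∈ H ∧ g.IsSwap}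
  have hS : ∀ g ∈ S, g.IsSwap := fun g hg => hg.2
  refine (Subgroup.closure_le (K := H)).mpr (fun g hg => hg.1)
    ((mem_closure_isSwap hS).mpr ⟨Set.toFinite _, fun x => ?_⟩)
  by_cases hx : f x = x
  · rw [hx]
    exact MulAction.mem_orbit_self x
  · rw [← swap_mem_closure_isSwap hS, swap_comm]
    exact Subgroup.subset_closure ⟨h x, x, f x, Ne.symm hx, rfl⟩

/-- The transposition of `j - 1` and `j` in `Fin n` (trivial if out of range). -/
def adjSwap (n j : ℕ) : Perm (Fin n) :=
  if h : 1 ≤ j ∧ j < n then swap ⟨j - 1, (Nat.sub_le j 1).trans_lt h.2⟩ ⟨j, h.2⟩ else 1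

theorem adjSwap_eq {n j : ℕ} (h : 1 ≤ j) (hj : j < n) :
    adjSwap n j = swap ⟨j - 1, (Nat.sub_le j 1).trans_lt hj⟩ ⟨j, hj⟩ := dif_pos ⟨h, hj⟩

theorem adjSwap_val {n j : ℕ} (h : 1 ≤ j) (hj : j < n) (x : Fin n) :
    (adjSwap n j x : ℕ) = if (x : ℕ) = j - 1 then j else if (x : ℕ) = j then j - 1 else x := by
  rw [adjSwap_eq h hj, swap_apply_def]
  simp only [Fin.ext_iff]
  split_ifs <;> rfl

theorem adjSwap_mul_self (n j : ℕ) : adjSwap n j * adjSwap n j = 1 := by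
  unfold adjSwap
  split_ifs
  · exact swap_mul_self _ _
  · exact one_mul 1

theorem adjSwap_commute {n i j : ℕ} (hij : i + 1 < j) : Commute (adjSwap n i) (adjSwap n j) := by
  unfold adjSwap
  split_ifs
  · apply Disjoint.commute
    intro x
    by_cases hx : x.val = j - 1 ∨ x.val = j
    · exact Or.inl (swap_apply_of_ne_of_ne (by simp only [ne_eq, Fin.ext_iff]; omega)
        (by simp only [ne_eq, Fin.ext_iff]; omega))
    · exact Or.inr (swap_apply_of_ne_of_ne (by simp only [ne_eq, Fin.ext_iff]; omega)
        (by simp only [ne_eq, Fin.ext_iff]; omega))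
  · exact Commute.one_right _
  · exact Commute.one_left _
  · exact Commute.one_left _

theorem orderOf_adjSwap {n j : ℕ} (h : 1 ≤ j) (hj : j < n) : orderOf (adjSwap n j) = 2 := by
  refine orderOf_eq_prime (by rw [pow_two, adjSwap_mul_self]) ?_
  rw [adjSwap_eq h hj, Ne, swap_eq_one_iff, Fin.ext_iff]
  simp only
  omega

theorem orderOf_adjSwap_mul_adjSwap {n j : ℕ} (h : 2 ≤ j) (hj : j < n) :
    orderOf (adjSwap n (j - 1) * adjSwap n j) = 3 := by
  rw [adjSwap_eq (by omega) (by omega), adjSwap_eq (by omega) hj, swap_comm]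
  exact (isThreeCycle_swap_mul_swap_same (by simp only [ne_eq, Fin.ext_iff]; omega)
    (by simp only [ne_eq, Fin.ext_iff]; omega)
    (by simp only [ne_eq, Fin.ext_iff]; omega)).orderOf

theorem swap_mem_of_adjSwap_mem {n : ℕ} {H : Subgroup (Perm (Fin n))} {x : Fin n} :
    ∀ {y : Fin n}, x < y → (∀ k, x.val < k → k ≤ y.val → adjSwap n k ∈ H) → swap x y ∈ H := by
  rintro ⟨y, hy⟩
  induction y with
  | zero => exact fun h => absurd h (Nat.not_lt_zero _)
  | succ y ih =>
    intro hxy h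
    have hs : swap (⟨y, by omega⟩ : Fin n) ⟨y + 1, hy⟩ ∈ H :=
      adjSwap_eq (n := n) (j := y + 1) (by omega) hy ▸ h (y + 1) hxy le_rfl
    by_cases hxy' : x = ⟨y, by omega⟩
    · rwa [hxy']
    · have hlt : x < ⟨y, by omega⟩ := lt_of_le_of_ne (Nat.lt_succ_iff.mp hxy) hxy'
      have := ih (by omega) hlt fun k h1 h2 => h k h1 (Nat.le_succ_of_le h2)
      rw [swap_comm, ← swap_mul_swap_mul_swap hlt.ne hxy.ne]
      exact mul_mem (mul_mem hs this) hs

/-- Young subgroups of the symmetric group are generated by adjacent transpositions. -/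
theorem mem_of_cuts {n : ℕ} {H : Subgroup (Perm (Fin n))} (E : Set ℕ) {σ : Perm (Fin n)}
    (hcut : ∀ k, 1 ≤ k → k < n → k ∉ E → ∀ x, (σ x).val < k ↔ x.val < k)
    (hH : ∀ k, 1 ≤ k → k < n → k ∈ E → adjSwap n k ∈ H) : σ ∈ H := by
  refine mem_of_forall_swap_mem fun x => ?_
  rcases lt_trichotomy x (σ x) with h | h | h
  · refine swap_mem_of_adjSwap_mem h fun k h1 h2 => hH k (by omega) (by omega) ?_
    by_contra hk
    have := hcut k (by omega) (by omega) hk x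
    omega
  · rw [← h, swap_self]
    exact one_mem H
  · rw [swap_comm]
    refine swap_mem_of_adjSwap_mem h fun k h1 h2 => hH k (by omega) (by omega) ?_
    by_contra hk
    have := hcut k (by omega) (by omega) hk x
    omega

/-- The common point set of the two families: two copies of `Fin n` and an extra point. -/
abbrev Pts (n : ℕ) : Type := Option (Bool × Fin n)

/-- Diagonal action of `Perm (Fin n)` on `Pts n`. -/
def diag (n : ℕ) : Perm (Fin n) →* Perm (Pts n) where
  toFun σ := optionCongr (prodCongrRight fun _ => σ)
  map_one' := by ext1 (_ | _) <;> rfl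
  map_mul' σ τ := by ext1 (_ | _) <;> rfl

@[simp] theorem diag_none {n : ℕ} (σ : Perm (Fin n)) : diag n σ none = none := rfl

@[simp] theorem diag_some {n : ℕ} (σ : Perm (Fin n)) (b : Bool) (i : Fin n) :
    diag n σ (some (b, i)) = some (b, σ i) := rfl

theorem diag_injective (n : ℕ) : Function.Injective (diag n) := fun σ τ h => by
  ext i
  have := congrArg (fun f : Perm (Pts n) => f (some (false, i))) h
  simp at this
  rw [this]

theorem sign_diag {n : ℕ} (σ : Perm (Fin n)) : sign (diag n σ) = 1 := by
  change sign (optionCongr (prodCongrRight fun _ : Bool => σ)) = 1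
  rw [optionCongr_sign, sign_prodCongrRight]
  simp

theorem diag_swap (i j : Fin n) (hij : i ≠ j) : diag n (swap i j) =
    swap (some (false, i)) (some (false, j)) * swap (some (true, i)) (some (true, j)) := by
  ext1 x
  rcases x with _ | ⟨b, k⟩
  · simp [swap_apply_def]
  · simp only [diag_some, mul_apply, swap_apply_def]
    cases b <;> simp <;> split_ifs <;> simp_all

/-- Exchanges the extra point with the base point of the first copy, and corresponding points of
the two copies away from the base points. -/
def copyFlip (n : ℕ) [NeZero n] : Perm (Pts n) :=
  swap none (some (false, 0)) * swap (some (false, 0)) (some (true, 0)) *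
    optionCongr (prodCongrLeft fun _ => swap false true)

section

variable {n : ℕ} [NeZero n]

@[simp] theorem copyFlip_none : copyFlip n none = some (false, 0) := by
  simp [copyFlip, swap_apply_def]

@[simp] theorem copyFlip_false_zero : copyFlip n (some (false, 0)) = none := by
  simp [copyFlip]

@[simp] theorem copyFlip_true_zero : copyFlip n (some (true, 0)) = some (true, 0) := by
  simp [copyFlip, swap_apply_def]

theorem copyFlip_of_ne_zero (b : Bool) {i : Fin n} (hi : i ≠ 0) :
    copyFlip n (some (b, i)) = some (!b, i) := by
  cases b <;> simp [copyFlip, swap_apply_def, hi]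

theorem copyFlip_mul_self : copyFlip n * copyFlip n = 1 := by
  ext1 x
  rcases x with _ | ⟨b, i⟩
  · simp
  · by_cases hi : i = 0
    · subst hi; cases b <;> simp
    · simp [copyFlip_of_ne_zero, hi]

theorem sign_copyFlip (hn : Even n) : sign (copyFlip n) = 1 := by
  rw [copyFlip, map_mul, map_mul, sign_swap (by simp), sign_swap (by simp), optionCongr_sign,
    sign_prodCongrLeft]
  simp [hn]

theorem copyFlip_commute_diag {σ : Perm (Fin n)} (hσ : σ 0 = 0) :
    Commute (copyFlip n) (diag n σ) := by
  ext1 x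
  rcases x with _ | ⟨b, i⟩
  · simp [hσ]
  · by_cases hi : i = 0
    · subst hi; cases b <;> simp [hσ]
    · have : σ i ≠ 0 := fun h => hi (σ.injective (h.trans hσ.symm))
      simp [copyFlip_of_ne_zero, hi, this]

theorem orderOf_copyFlip : orderOf (copyFlip n) = 2 :=
  orderOf_eq_prime (by rw [pow_two, copyFlip_mul_self]) fun h => by
    have := congrArg (fun f : Perm (Pts n) => f none) h
    simp at this

theorem orderOf_copyFlip_mul_diag (hn : 3 ≤ n) :
    orderOf (copyFlip n * diag n (adjSwap n 1)) = 10 := by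
  set X := copyFlip n * diag n (adjSwap n 1)
  have h01 : adjSwap n 1 0 = ⟨1, by omega⟩ := by
    rw [adjSwap_eq (by omega) (by omega)]; exact swap_apply_left _ _
  have h10 : adjSwap n 1 ⟨1, by omega⟩ = 0 := by
    rw [adjSwap_eq (by omega) (by omega)]; exact swap_apply_right _ _
  have h1 : (⟨1, by omega⟩ : Fin n) ≠ 0 := by simp [Fin.ext_iff]
  have x0 : X none = some (false, 0) := by simp [X]
  have x1 : X (some (false, 0)) = some (true, ⟨1, by omega⟩) := by
    simp [X, h01, copyFlip_of_ne_zero, h1]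
  have x2 : X (some (true, ⟨1, by omega⟩)) = some (true, 0) := by simp [X, h10]
  have x3 : X (some (true, 0)) = some (false, ⟨1, by omega⟩) := by
    simp [X, h01, copyFlip_of_ne_zero, h1]
  have x4 : X (some (false, ⟨1, by omega⟩)) = none := by simp [X, h10]
  have x5 : ∀ b (i : Fin n), 2 ≤ i.val → X (some (b, i)) = some (!b, i) := fun b i hi => by
    have hi' : adjSwap n 1 i = i := by
      ext; rw [adjSwap_val (by omega) (by omega)]; split_ifs <;> omega
    have hi0 : i ≠ 0 := by rintro rfl; simp at hi
    simp [X, hi', copyFlip_of_ne_zero, hi0]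
  refine orderOf_eq_of_pow_and_pow_div_prime (by norm_num) ?_ ?_
  · ext1 x
    rcases x with _ | ⟨b, i⟩
    · simp [pow_succ, x0, x1, x2, x3, x4]
    · by_cases hi : 2 ≤ i.val
      · simp [pow_succ, x5 _ i hi]
      · obtain h | h : i = 0 ∨ i = ⟨1, by omega⟩ := by
          simp only [Fin.ext_iff, Fin.val_zero]; omega
        all_goals rw [h]; cases b <;> simp [pow_succ, x0, x1, x2, x3, x4]
  · intro p hp hp10 h
    have hp' : p = 2 ∨ p = 5 := by
      have : p ∈ Nat.primeFactors 10 := Nat.mem_primeFactors.mpr ⟨hp, hp10, by norm_num⟩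
      rw [show (10 : ℕ) = 2 * 5 from rfl, Nat.primeFactors_mul (by norm_num) (by norm_num),
        Nat.prime_two.primeFactors, Nat.prime_five.primeFactors] at this
      simpa using this
    rcases hp' with rfl | rfl
    · have := congrArg (fun f : Perm (Pts n) => f (some (false, ⟨2, hn⟩))) h
      simp [pow_succ, x5 _ ⟨2, hn⟩ le_rfl] at this
    · have := congrArg (fun f : Perm (Pts n) => f none) h
      simp [pow_succ, x0, x1] at this

theorem alternatingGroup_le_of_copyFlip_diag (hn : 3 ≤ n) {G : Subgroup (Perm (Pts n))}
    (hcopyFlip : copyFlip n ∈ G) (hdiag : ∀ σ, diag n σ ∈ G) : alternatingGroup (Pts n) ≤ G := by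
  have hinv : (copyFlip n)⁻¹ = copyFlip n := inv_eq_of_mul_eq_one_left copyFlip_mul_self
  have h1 : (⟨1, by omega⟩ : Fin n) ≠ 0 := by simp [Fin.ext_iff]
  have h2 : (⟨2, by omega⟩ : Fin n) ≠ 0 := by simp [Fin.ext_iff]
  have h12 : (⟨1, by omega⟩ : Fin n) ≠ ⟨2, by omega⟩ := by simp
  generalize (⟨1, by omega⟩ : Fin n) = i at h1 h12
  generalize (⟨2, by omega⟩ : Fin n) = j at h2 h12
  have hA : swap none (some (true, i)) * swap (some (true, 0)) (some (false, i)) ∈ G := by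
    have : copyFlip n * diag n (swap 0 i) * (copyFlip n)⁻¹ ∈ G :=
      mul_mem (mul_mem hcopyFlip (hdiag _)) (inv_mem hcopyFlip)
    rw [diag_swap _ _ h1.symm, ← conj_mul, ← swap_apply_apply, ← swap_apply_apply] at this
    simpa [copyFlip_of_ne_zero, h1] using this
  have hB : swap none (some (true, i)) * swap (some (true, j)) (some (false, i)) ∈ G := by
    have := mul_mem (mul_mem (hdiag (swap 0 j)) hA) (inv_mem (hdiag (swap 0 j)))
    rw [← conj_mul, ← swap_apply_apply, ← swap_apply_apply] at this
    simpa [swap_apply_of_ne_of_ne h1 h12] using this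
  have hC : swap (some (false, i)) (some (true, 0)) *
      swap (some (false, i)) (some (true, j)) ∈ G := by
    have := mul_mem (inv_mem hA) hB
    simpa [mul_assoc, swap_comm] using this
  have hprim : MulAction.IsPreprimitive G (Pts n) := by
    have act : ∀ {B : Set (Pts n)}, MulAction.IsBlock G B → ∀ g ∈ G, ∀ x ∈ B, g x ∈ B →
        ∀ y ∈ B, g y ∈ B := fun hB g hg x hx hgx y hy => by
      have hgB := hB.smul_eq_of_mem (g := (⟨g, hg⟩ : G)) hx hgx
      rw [← hgB]
      exact Set.smul_mem_smul_set hy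
    refine MulAction.IsPreprimitive.of_isTrivialBlock_of_notMem_fixedPoints (a := none) ?_ ?_
    · intro h
      have := h ⟨copyFlip n, hcopyFlip⟩
      simp [Subgroup.smul_def] at this
    · intro B hnone hB
      refine or_iff_not_imp_left.mpr fun hsub => ?_
      rw [Set.not_subsingleton_iff] at hsub
      obtain ⟨x, hx, hxne⟩ := hsub.exists_ne none
      have copy : ∀ b i, some (b, i) ∈ B → ∀ j, some (b, j) ∈ B := fun b i hi j => by
        simpa using act hB _ (hdiag (swap i j)) none hnone (by simpa using hnone) _ hi
      have ofFalse : some (false, 0) ∈ B → ∀ b j, some (b, j) ∈ B := fun h b => by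
        cases b
        · exact copy _ _ h
        · have := act hB _ hcopyFlip none hnone (by simpa using h) _ (copy _ _ h i)
          rw [copyFlip_of_ne_zero _ h1] at this
          exact copy _ _ this
      have hzero : some (false, 0) ∈ B := by
        rcases x with _ | ⟨_ | _, k⟩
        · exact absurd rfl hxne
        · exact copy _ _ hx 0
        · have h0 := copy _ _ hx 0
          simpa using act hB _ hcopyFlip _ h0 (by simpa using h0) _ hnone
      refine Set.eq_univ_of_forall fun y => ?_
      rcases y with _ | ⟨b, j⟩
      · exact hnone
      · exact ofFalse hzero b j
  exact alternatingGroup_le_of_isPreprimitive_of_isThreeCycle_mem hprim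
    (isThreeCycle_swap_mul_swap_same (by simp) (by simp) (by simpa using h2.symm)) hC

end

/-- The index in `Fin n` underlying a point, the extra point being put at index `0`. -/
def level {n : ℕ} : Pts n → ℕ
  | none => 0
  | some (_, i) => i

/-- The permutations preserving the set of points of level less than `k`. -/
def cut (n k : ℕ) : Subgroup (Perm (Pts n)) where
  carrier := {g | ∀ x, level (g x) < k ↔ level x < k}
  mul_mem' {g h} hg hh x := (hg (h x)).trans (hh x)
  one_mem' _ := Iff.rfl
  inv_mem' {g} hg x := by simpa using (hg (g⁻¹ x)).symm

theorem mem_cut {n k : ℕ} {g : Perm (Pts n)} :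
    g ∈ cut n k ↔ ∀ x, level (g x) < k ↔ level x < k := Iff.rfl

theorem diag_mem_cut {n k : ℕ} {σ : Perm (Fin n)} :
    diag n σ ∈ cut n k ↔ ∀ x, (σ x).val < k ↔ x.val < k := by
  refine ⟨fun h x => h (some (false, x)), fun h x => ?_⟩
  rcases x with _ | ⟨b, i⟩
  · exact Iff.rfl
  · exact h i

theorem diag_adjSwap_mem_cut {n j k : ℕ} (hjk : j ≠ k) : diag n (adjSwap n j) ∈ cut n k := by
  rw [diag_mem_cut]
  intro x
  by_cases h : 1 ≤ j ∧ j < n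
  · rw [adjSwap_val h.1 h.2]
    split_ifs <;> omega
  · rw [adjSwap, dif_neg h, one_apply]

section

variable {n : ℕ} [NeZero n]

theorem copyFlip_mem_cut (k : ℕ) : copyFlip n ∈ cut n k := by
  rw [mem_cut]
  rintro (_ | ⟨b, i⟩)
  · simp [level]
  · by_cases hi : i = 0
    · subst hi; cases b <;> simp [level]
    · simp [copyFlip_of_ne_zero, hi, level]

theorem exists_isStringCGroupRep_of_diag {l N : ℕ} (hN : N = 2 * n + 1) (hn : Even n) (h3 : 3 ≤ n)
    (s : ℕ → Perm (Fin n)) (hord : ∀ j, 1 ≤ j → j < l + 1 → orderOf (s j) = 2)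
    (h1 : s 1 = adjSwap n 1) (hfix : ∀ j, 2 ≤ j → j < l + 1 → s j 0 = 0)
    (hcomm : ∀ i j, 1 ≤ i → i + 1 < j → j < l + 1 → Commute (s i) (s j))
    (Q : ℕ → Subgroup (Perm (Pts n))) (hflip : ∀ k, copyFlip n ∈ Q k)
    (hQ : ∀ j k, 1 ≤ j → j < l + 1 → k < l + 1 → j ≠ k → diag n (s j) ∈ Q k)
    (hsep : ∀ (E : Set ℕ) (H : Subgroup (Perm (Fin n))) (σ : Perm (Fin n)),
      (∀ j ∈ E, 1 ≤ j → j < l + 1 → s j ∈ H) →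
      (∀ k ∉ E, 1 ≤ k → k < l + 1 → diag n σ ∈ Q k) → σ ∈ H) :
    ∃ ρ : Fin (l + 1) → alternatingGroup (Fin N), IsStringCGroupRep ρ ∧
      ∀ (i : ℕ) (_ : 1 ≤ i) (hi : i < l + 1), orderOf (ρ ⟨i - 1, by omega⟩ * ρ ⟨i, hi⟩) =
        if i = 1 then 10 else orderOf (s (i - 1) * s i) := by
  set σ : Fin (l + 1) → Perm (Pts n) := fun i => if i.val = 0 then copyFlip n else diag n (s i)
  have σ_zero : ∀ i : Fin (l + 1), i.val = 0 → σ i = copyFlip n := fun i hi => if_pos hi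
  have σ_pos : ∀ i : Fin (l + 1), 1 ≤ i.val → σ i = diag n (s i) := fun i hi =>
    if_neg (by omega)
  have σ_comm : ∀ i j : Fin (l + 1), i.val + 1 < j.val → Commute (σ i) (σ j) := by
    intro i j hij
    rw [σ_pos j (by omega)]
    by_cases hi : i.val = 0
    · rw [σ_zero i hi]
      exact copyFlip_commute_diag (hfix j (by omega) j.2)
    · rw [σ_pos i (by omega)]
      exact (hcomm i j (by omega) hij j.2).map (diag n)
  have σ_ord : ∀ i, orderOf (σ i) = 2 := fun i => by
    by_cases hi : i.val = 0
    · rw [σ_zero i hi]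
      exact orderOf_copyFlip
    · rw [σ_pos i (by omega), orderOf_injective _ (diag_injective n)]
      exact hord i (by omega) i.2
  have hgen : Subgroup.closure (Set.range σ) = alternatingGroup (Pts n) := by
    apply le_antisymm
    · rw [Subgroup.closure_le]
      rintro _ ⟨i, rfl⟩
      by_cases hi : i.val = 0
      · rw [σ_zero i hi]
        exact sign_copyFlip hn
      · rw [σ_pos i (by omega)]
        exact sign_diag _
    · refine alternatingGroup_le_of_copyFlip_diag h3
        (Subgroup.subset_closure ⟨0, σ_zero 0 rfl⟩) fun τ => ?_
      refine hsep Set.univ ((Subgroup.closure (Set.range σ)).comap (diag n)) τ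
        (fun j _ hj hjl => ?_) fun k hk => absurd (Set.mem_univ k) hk
      exact Subgroup.subset_closure ⟨⟨j, hjl⟩, σ_pos ⟨j, hjl⟩ hj⟩
  have hint := intersection_property_of_separating σ_comm
    (fun k => if k.val = 0 then ⊤ else Q k) (fun j k hjk => ?_) (fun J _ g hg hgQ => ?_)
  · obtain ⟨ρ, hρ, hρo⟩ := exists_isStringCGroupRep_alternatingGroup (N := N) (σ := σ)
      (Fintype.equivFinOfCardEq (by simp [hN])) σ_ord hgen σ_comm hint
    refine ⟨ρ, hρ, fun i hi1 hil => ?_⟩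
    rw [hρo, σ_pos ⟨i, hil⟩ hi1]
    split_ifs with hi
    · rw [σ_zero _ (by simp [hi])]
      subst hi
      rw [h1]
      exact orderOf_copyFlip_mul_diag h3
    · rw [σ_pos _ (by simp only; omega), ← map_mul]
      exact orderOf_injective _ (diag_injective n) _
  · have hjk' : j.val ≠ k.val := fun h => hjk (Fin.ext h)
    by_cases hk : k.val = 0
    · simp [hk]
    · simp only [if_neg hk]
      by_cases hj : j.val = 0
      · rw [σ_zero j hj]
        exact hflip k
      · rw [σ_pos j (by omega)]
        exact hQ j k (by omega) j.2 k.2 hjk'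
  · obtain ⟨τ, rfl⟩ : g ∈ (diag n).range := by
      refine (Subgroup.closure_le _).mpr ?_ hg
      rintro _ ⟨i, hi, rfl⟩
      rw [σ_pos i (Nat.one_le_iff_ne_zero.mpr fun h => hi (Fin.ext h))]
      exact ⟨_, rfl⟩
    refine hsep {j | ∃ h : j < l + 1, (⟨j, h⟩ : Fin (l + 1)) ∈ J}
      ((Subgroup.closure (σ '' J)).comap (diag n)) τ ?_ ?_
    · rintro j ⟨hjl, hjJ⟩ hj -
      exact Subgroup.subset_closure ⟨⟨j, hjl⟩, hjJ, σ_pos ⟨j, hjl⟩ hj⟩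
    · intro k hk hk1 hkl
      have := hgQ ⟨k, hkl⟩ (fun h => hk ⟨hkl, h⟩) (by simp [Fin.ext_iff]; omega)
      rwa [if_neg (by simp only; omega)] at this

end

theorem adjSwap_zero {n j : ℕ} [NeZero n] (hj : 2 ≤ j) : adjSwap n j 0 = 0 := by
  by_cases h : 1 ≤ j ∧ j < n
  · ext
    rw [adjSwap_val h.1 h.2, Fin.val_zero]
    split_ifs <;> omega
  · rw [adjSwap, dif_neg h, one_apply]

theorem exists_rep_ten_threes (l : ℕ) (hl : Even (l + 1)) (h4 : 4 ≤ l + 1) :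
    ∃ ρ : Fin (l + 1) → alternatingGroup (Fin (2 * (l + 1) + 1)), IsStringCGroupRep ρ ∧
      ∀ (i : ℕ) (_ : 1 ≤ i) (hi : i < l + 1),
        orderOf (ρ ⟨i - 1, by omega⟩ * ρ ⟨i, hi⟩) = if i = 1 then 10 else 3 := by
  obtain ⟨ρ, hρ, hord⟩ := exists_isStringCGroupRep_of_diag (n := l + 1) (l := l) rfl hl (by omega)
    (adjSwap (l + 1)) (fun j => orderOf_adjSwap) rfl (fun j h _ => adjSwap_zero h)
    (fun i j _ h _ => adjSwap_commute h) (cut (l + 1)) copyFlip_mem_cut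
    (fun j k _ _ _ => diag_adjSwap_mem_cut)
    (fun E H σ hH hσ => mem_of_cuts E
      (fun k hk1 hkl hk => diag_mem_cut.mp (hσ k hk hk1 hkl)) fun k hk1 hkl hk => hH k hk hk1 hkl)
  refine ⟨ρ, hρ, fun i hi1 hi => (hord i hi1 hi).trans ?_⟩
  split_ifs
  · rfl
  · exact orderOf_adjSwap_mul_adjSwap (by omega) hi

section

variable (m : ℕ)

/-- The product of two disjoint adjacent transpositions at the end of `Fin (m + 6)`. -/
def doubleSwap : Perm (Fin (m + 6)) := adjSwap (m + 6) (m + 3) * adjSwap (m + 6) (m + 5)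

/-- The reversal of the last four points of `Fin (m + 6)`. -/
def endReversal : Perm (Fin (m + 6)) := (doubleSwap m * adjSwap (m + 6) (m + 4)) ^ 2

theorem doubleSwap_val (x : Fin (m + 6)) : (doubleSwap m x : ℕ) =
    if (x : ℕ) = m + 2 then m + 3 else if (x : ℕ) = m + 3 then m + 2 else
      if (x : ℕ) = m + 4 then m + 5 else if (x : ℕ) = m + 5 then m + 4 else x := by
  rw [doubleSwap, mul_apply, adjSwap_val (by omega) (by omega), adjSwap_val (by omega) (by omega)]
  split_ifs <;> omega

theorem doubleSwap_mul_adjSwap_val (x : Fin (m + 6)) :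
    ((doubleSwap m * adjSwap (m + 6) (m + 4)) x : ℕ) =
      if (x : ℕ) = m + 2 then m + 3 else if (x : ℕ) = m + 3 then m + 5 else
        if (x : ℕ) = m + 4 then m + 2 else if (x : ℕ) = m + 5 then m + 4 else x := by
  rw [mul_apply, doubleSwap_val, adjSwap_val (by omega) (by omega)]
  split_ifs <;> omega

theorem endReversal_val (x : Fin (m + 6)) : (endReversal m x : ℕ) =
    if m + 2 ≤ (x : ℕ) then 2 * m + 7 - x else x := by
  rw [endReversal, pow_two, mul_apply, doubleSwap_mul_adjSwap_val, doubleSwap_mul_adjSwap_val]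
  split_ifs <;> omega

theorem endReversal_commute_doubleSwap : Commute (endReversal m) (doubleSwap m) := by
  ext x
  simp only [mul_apply, endReversal_val, doubleSwap_val]
  split_ifs <;> omega

theorem endReversal_commute_adjSwap {j : ℕ} (hj : 1 ≤ j) (hj' : j ≤ m + 1 ∨ j = m + 4) :
    Commute (endReversal m) (adjSwap (m + 6) j) := by
  ext x
  simp only [mul_apply, endReversal_val, adjSwap_val (n := m + 6) hj (by omega)]
  split_ifs <;> omega

theorem doubleSwap_mul_self : doubleSwap m * doubleSwap m = 1 := by
  ext x
  rw [mul_apply, doubleSwap_val, doubleSwap_val, one_apply]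
  split_ifs <;> omega

theorem orderOf_doubleSwap : orderOf (doubleSwap m) = 2 :=
  orderOf_eq_prime (by rw [pow_two, doubleSwap_mul_self]) fun h => by
    have := doubleSwap_val m ⟨m + 2, by omega⟩
    rw [h, one_apply, if_pos rfl] at this
    simp at this

theorem orderOf_adjSwap_mul_doubleSwap :
    orderOf (adjSwap (m + 6) (m + 2) * doubleSwap m) = 6 := by
  have h3 : orderOf (adjSwap (m + 6) (m + 2) * adjSwap (m + 6) (m + 3)) = 3 :=
    orderOf_adjSwap_mul_adjSwap (j := m + 3) (by omega) (by omega)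
  have h2 : orderOf (adjSwap (m + 6) (m + 5)) = 2 := orderOf_adjSwap (by omega) (by omega)
  rw [doubleSwap, ← mul_assoc, Commute.orderOf_mul_eq_mul_orderOf_of_coprime, h3, h2]
  · exact (adjSwap_commute (by omega)).mul_left (adjSwap_commute (by omega))
  · rw [h3, h2]; norm_num

theorem orderOf_doubleSwap_mul_adjSwap :
    orderOf (doubleSwap m * adjSwap (m + 6) (m + 4)) = 4 := by
  refine orderOf_eq_prime_pow (p := 2) (n := 1) ?_ ?_
  · rw [pow_one]
    intro h
    have := endReversal_val m ⟨m + 2, by omega⟩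
    rw [endReversal, h, one_apply, if_pos le_rfl] at this
    simp only at this
    omega
  · rw [show 2 ^ (1 + 1) = 2 * 2 from rfl, pow_mul, ← endReversal, pow_two]
    ext x
    rw [mul_apply, endReversal_val, endReversal_val, one_apply]
    split_ifs <;> omega

/-- The generators of `Perm (Fin (m + 6))` indexed by `1, …, m + 4`. -/
def reducedSwap (j : ℕ) : Perm (Fin (m + 6)) :=
  if j = m + 3 then doubleSwap m else adjSwap (m + 6) j

theorem reducedSwap_self : reducedSwap m (m + 3) = doubleSwap m := if_pos rfl

theorem reducedSwap_of_ne {j : ℕ} (hj : j ≠ m + 3) : reducedSwap m j = adjSwap (m + 6) j :=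
  if_neg hj

/-- Subgroups separating the generators `reducedSwap m`. -/
def reducedSep (k : ℕ) : Subgroup (Perm (Pts (m + 6))) :=
  if k = m + 2 then cut (m + 6) k ⊓ Subgroup.centralizer {diag (m + 6) (endReversal m)}
  else if k = m + 3 then cut (m + 6) k ⊓ cut (m + 6) (m + 5) else cut (m + 6) k

theorem reducedSep_le_cut (k : ℕ) : reducedSep m k ≤ cut (m + 6) k := by
  unfold reducedSep
  split_ifs
  exacts [inf_le_left, inf_le_left, le_rfl]

theorem diag_mem_centralizer_endReversal {σ : Perm (Fin (m + 6))} :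
    diag (m + 6) σ ∈ Subgroup.centralizer {diag (m + 6) (endReversal m)} ↔
      Commute (endReversal m) σ := by
  rw [Subgroup.mem_centralizer_singleton_iff, ← map_mul, ← map_mul,
    (diag_injective _).eq_iff, Commute, SemiconjBy, eq_comm]

theorem copyFlip_mem_reducedSep (k : ℕ) : copyFlip (m + 6) ∈ reducedSep m k := by
  unfold reducedSep
  split_ifs
  · refine ⟨copyFlip_mem_cut k, ?_⟩
    refine Subgroup.mem_centralizer_singleton_iff.mpr (copyFlip_commute_diag ?_).eq
    ext
    rw [endReversal_val]
    simp
  · exact ⟨copyFlip_mem_cut k, copyFlip_mem_cut _⟩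
  · exact copyFlip_mem_cut k

theorem diag_reducedSwap_mem_reducedSep {j k : ℕ} (hj1 : 1 ≤ j) (hj : j < m + 5)
    (hk : k < m + 5) (hjk : j ≠ k) : diag (m + 6) (reducedSwap m j) ∈ reducedSep m k := by
  have hcut : ∀ i, i ≠ j → (j = m + 3 → i ≠ m + 5) →
      diag (m + 6) (reducedSwap m j) ∈ cut (m + 6) i := fun i hi hi' => by
    by_cases h : j = m + 3
    · rw [h, reducedSwap_self, doubleSwap, map_mul]
      exact mul_mem (diag_adjSwap_mem_cut (by omega)) (diag_adjSwap_mem_cut (hi' h).symm)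
    · rw [reducedSwap_of_ne m h]
      exact diag_adjSwap_mem_cut hi.symm
  unfold reducedSep
  split_ifs with h2 h3
  · refine ⟨hcut k hjk.symm (by omega), (diag_mem_centralizer_endReversal m).mpr ?_⟩
    by_cases h : j = m + 3
    · rw [h, reducedSwap_self]
      exact endReversal_commute_doubleSwap m
    · rw [reducedSwap_of_ne m h]
      exact endReversal_commute_adjSwap m hj1 (by omega)
  · exact ⟨hcut k hjk.symm (by omega), hcut _ (by omega) (by omega)⟩
  · exact hcut k hjk.symm (by omega)

variable {m}

theorem commute_endReversal_of_mem {σ : Perm (Fin (m + 6))}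
    (h : diag (m + 6) σ ∈ reducedSep m (m + 2)) : Commute (endReversal m) σ := by
  rw [reducedSep, if_pos rfl] at h
  exact (diag_mem_centralizer_endReversal m).mp h.2

theorem val_lt_iff_of_mem {k : ℕ} {σ : Perm (Fin (m + 6))}
    (h : diag (m + 6) σ ∈ reducedSep m k) (x : Fin (m + 6)) : (σ x).val < k ↔ x.val < k :=
  diag_mem_cut.mp (reducedSep_le_cut m k h) x

variable {E : Set ℕ} {H : Subgroup (Perm (Fin (m + 6)))} {σ : Perm (Fin (m + 6))}

theorem mem_of_reducedSep_of_joined (hE : m + 3 ∈ E → m + 2 ∈ E)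
    (hH : ∀ j ∈ E, 1 ≤ j → j < m + 5 → reducedSwap m j ∈ H)
    (hσ : ∀ k ∉ E, 1 ≤ k → k < m + 5 → diag (m + 6) σ ∈ reducedSep m k) : σ ∈ H := by
  have hlast : m + 3 ∈ E → adjSwap (m + 6) (m + 5) ∈ H := fun h => by
    have ht := hH _ h (by omega) (by omega)
    have hv := hH _ (hE h) (by omega) (by omega)
    rw [reducedSwap_self] at ht
    rw [reducedSwap_of_ne m (by omega)] at hv
    have hcomm : Commute (adjSwap (m + 6) (m + 2) * adjSwap (m + 6) (m + 3))
        (adjSwap (m + 6) (m + 5)) :=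
      (adjSwap_commute (by omega)).mul_left (adjSwap_commute (by omega))
    have hord : orderOf (adjSwap (m + 6) (m + 2) * adjSwap (m + 6) (m + 3)) = 3 :=
      orderOf_adjSwap_mul_adjSwap (j := m + 3) (by omega) (by omega)
    have h3 := orderOf_dvd_iff_pow_eq_one.mp hord.dvd
    have := pow_mem (mul_mem hv ht) 3
    rwa [doubleSwap, ← mul_assoc, hcomm.mul_pow, h3, one_mul, pow_succ, pow_two,
      adjSwap_mul_self, one_mul] at this
  refine mem_of_cuts {k | k ∈ E ∧ k ≤ m + 4 ∨ k = m + 5 ∧ m + 3 ∈ E} ?_ ?_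
  · intro k hk1 hk hkE
    rw [Set.mem_ofPred_eq] at hkE
    by_cases hk5 : k = m + 5
    · have := hσ (m + 3) (fun h => hkE (Or.inr ⟨hk5, h⟩)) (by omega) (by omega)
      rw [reducedSep, if_neg (by omega), if_pos rfl] at this
      exact diag_mem_cut.mp (hk5 ▸ this.2)
    · exact val_lt_iff_of_mem (hσ k (fun h => hkE (Or.inl ⟨h, by omega⟩)) hk1 (by omega))
  · rintro k hk1 - (⟨hkE, hk⟩ | ⟨rfl, h⟩)
    · by_cases hk3 : k = m + 3
      · subst hk3
        have := mul_mem (hH _ hkE hk1 (by omega)) (inv_mem (hlast hkE))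
        rwa [reducedSwap_self, doubleSwap, mul_inv_cancel_right] at this
      · rw [← reducedSwap_of_ne m hk3]
        exact hH k hkE hk1 (by omega)
    · exact hlast h

theorem mem_of_reducedSep_of_fixed (hE : m + 2 ∉ E)
    (hH : ∀ j ∈ E, 1 ≤ j → j < m + 5 → reducedSwap m j ∈ H)
    (hσ : ∀ k ∉ E, 1 ≤ k → k < m + 5 → diag (m + 6) σ ∈ reducedSep m k)
    (hfix : σ ⟨m + 2, by omega⟩ = ⟨m + 2, by omega⟩) : σ ∈ H := by
  have hσ2 := hσ _ hE (by omega) (by omega)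
  have hrev : endReversal m ⟨m + 2, by omega⟩ = ⟨m + 5, by omega⟩ := by
    ext
    rw [endReversal_val, if_pos le_rfl]
    simp only
    omega
  have hfix' : σ ⟨m + 5, by omega⟩ = ⟨m + 5, by omega⟩ := by
    have := congrArg (fun f : Perm (Fin (m + 6)) => f ⟨m + 2, by omega⟩)
      (commute_endReversal_of_mem hσ2).eq
    simpa [hfix, hrev] using this.symm
  have hiff : ∀ x y, σ y = y → ((σ x).val = y.val ↔ x.val = y.val) := fun x y hy => by
    rw [← Fin.ext_iff, ← Fin.ext_iff]
    conv_lhs => rw [← hy]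
    exact σ.injective.eq_iff
  refine mem_of_cuts {k | k ∈ E ∧ k ≠ m + 3 ∧ k ≤ m + 4} ?_ ?_
  · intro k hk1 hk hkE x
    have hx2 := val_lt_iff_of_mem hσ2 x
    have h2 := hiff x _ hfix
    have h5 := hiff x _ hfix'
    simp only at h2 h5
    by_cases hk5 : k = m + 5
    · omega
    by_cases hk3 : k = m + 3
    · omega
    exact val_lt_iff_of_mem (hσ k (fun h => hkE ⟨h, hk3, by omega⟩) hk1 (by omega)) x
  · rintro k hk1 - ⟨hkE, hk3, hk4⟩
    rw [← reducedSwap_of_ne m hk3]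
    exact hH k hkE hk1 (by omega)

theorem mem_of_reducedSep
    (hH : ∀ j ∈ E, 1 ≤ j → j < m + 5 → reducedSwap m j ∈ H)
    (hσ : ∀ k ∉ E, 1 ≤ k → k < m + 5 → diag (m + 6) σ ∈ reducedSep m k) : σ ∈ H := by
  by_cases hE : m + 3 ∈ E → m + 2 ∈ E
  · exact mem_of_reducedSep_of_joined hE hH hσ
  obtain ⟨h3, h2⟩ := Classical.not_imp.mp hE
  suffices ∃ d ∈ H, (∀ k ∉ E, 1 ≤ k → k < m + 5 → diag (m + 6) d ∈ reducedSep m k) ∧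
      d ⟨m + 2, by omega⟩ = σ ⟨m + 2, by omega⟩ by
    obtain ⟨d, hd, hdQ, hdσ⟩ := this
    refine (Subgroup.mul_mem_cancel_left H (inv_mem hd)).mp
      (mem_of_reducedSep_of_fixed h2 hH (fun k hk hk1 hk5 => ?_) ?_)
    · rw [map_mul, map_inv]
      exact mul_mem (inv_mem (hdQ k hk hk1 hk5)) (hσ k hk hk1 hk5)
    · rw [mul_apply, Equiv.Perm.inv_eq_iff_eq, hdσ]
  have hgen : ∀ j ∈ E, 1 ≤ j → j < m + 5 →
      ∀ k ∉ E, 1 ≤ k → k < m + 5 → diag (m + 6) (reducedSwap m j) ∈ reducedSep m k :=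
    fun j hj hj1 hj5 k hk _ hk5 =>
      diag_reducedSwap_mem_reducedSep m hj1 hj5 hk5 fun h => hk (h ▸ hj)
  have ht := hH _ h3 (by omega) (by omega)
  have htQ := hgen _ h3 (by omega) (by omega)
  rw [reducedSwap_self] at ht htQ
  have hu : m + 4 ∈ E → adjSwap (m + 6) (m + 4) ∈ H := fun h => by
    rw [← reducedSwap_of_ne m (by omega)]
    exact hH _ h (by omega) (by omega)
  have huQ : m + 4 ∈ E → ∀ k ∉ E, 1 ≤ k → k < m + 5 →
      diag (m + 6) (adjSwap (m + 6) (m + 4)) ∈ reducedSep m k := fun h => by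
    rw [← reducedSwap_of_ne m (by omega)]
    exact hgen _ h (by omega) (by omega)
  have hge := val_lt_iff_of_mem (hσ _ h2 (by omega) (by omega)) ⟨m + 2, by omega⟩
  have h4 : m + 4 ≤ (σ ⟨m + 2, by omega⟩).val → m + 4 ∈ E := fun h => by
    by_contra h'
    have := val_lt_iff_of_mem (hσ _ h' (by omega) (by omega)) ⟨m + 2, by omega⟩
    simp only at this
    omega
  have hlt := (σ ⟨m + 2, by omega⟩).isLt
  simp only [lt_irrefl, iff_false, not_lt] at hge
  obtain h | h | h | h : (σ ⟨m + 2, by omega⟩).val = m + 2 ∨ (σ ⟨m + 2, by omega⟩).val = m + 3 ∨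
    (σ ⟨m + 2, by omega⟩).val = m + 4 ∨ (σ ⟨m + 2, by omega⟩).val = m + 5 := by omega
  · refine ⟨1, one_mem H, fun k _ _ _ => ?_, ?_⟩
    · rw [map_one]
      exact one_mem _
    · ext
      rw [h, one_apply]
  · refine ⟨doubleSwap m, ht, htQ, ?_⟩
    ext
    rw [h, doubleSwap_val, if_pos rfl]
  · refine ⟨adjSwap (m + 6) (m + 4) * doubleSwap m, mul_mem (hu (h4 h.ge)) ht,
      fun k hk hk1 hk5 => ?_, ?_⟩
    · rw [map_mul]
      exact mul_mem (huQ (h4 h.ge) k hk hk1 hk5) (htQ k hk hk1 hk5)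
    · ext
      rw [h, mul_apply, adjSwap_val (by omega) (by omega), doubleSwap_val, if_pos rfl,
        if_pos (by omega)]
  · have hE4 := h4 (by omega)
    refine ⟨doubleSwap m * (adjSwap (m + 6) (m + 4) * doubleSwap m),
      mul_mem ht (mul_mem (hu hE4) ht), fun k hk hk1 hk5 => ?_, ?_⟩
    · rw [map_mul, map_mul]
      exact mul_mem (htQ k hk hk1 hk5) (mul_mem (huQ hE4 k hk hk1 hk5) (htQ k hk hk1 hk5))
    · ext
      rw [h, ← mul_assoc, mul_apply, doubleSwap_mul_adjSwap_val, doubleSwap_val, if_pos rfl,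
        if_neg (by omega), if_pos rfl]

end

theorem exists_rep_ten_threes_six_four (m : ℕ) (hm : Even m) :
    ∃ ρ : Fin (m + 5) → alternatingGroup (Fin (2 * (m + 5) + 3)), IsStringCGroupRep ρ ∧
      ∀ (i : ℕ) (_ : 1 ≤ i) (hi : i < m + 5), orderOf (ρ ⟨i - 1, by omega⟩ * ρ ⟨i, hi⟩) =
        if i = 1 then 10 else if i = m + 3 then 6 else if i = m + 4 then 4 else 3 := by
  have hord : ∀ j, 1 ≤ j → j < m + 5 → orderOf (reducedSwap m j) = 2 := fun j hj1 hj => by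
    by_cases h : j = m + 3
    · rw [h, reducedSwap_self]
      exact orderOf_doubleSwap m
    · rw [reducedSwap_of_ne m h]
      exact orderOf_adjSwap hj1 (by omega)
  have hfix : ∀ j, 2 ≤ j → j < m + 4 + 1 → reducedSwap m j 0 = 0 := fun j hj _ => by
    by_cases h : j = m + 3
    · rw [h, reducedSwap_self, doubleSwap, mul_apply, adjSwap_zero (by omega),
        adjSwap_zero (by omega)]
    · rw [reducedSwap_of_ne m h, adjSwap_zero hj]
  have hcomm : ∀ i j, 1 ≤ i → i + 1 < j → j < m + 4 + 1 →
      Commute (reducedSwap m i) (reducedSwap m j) := fun i j hi hij hj => by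
    rw [reducedSwap_of_ne m (j := i) (by omega)]
    by_cases h : j = m + 3
    · rw [h, reducedSwap_self, doubleSwap]
      exact (adjSwap_commute (by omega)).mul_right (adjSwap_commute (by omega))
    · rw [reducedSwap_of_ne m h]
      exact adjSwap_commute hij
  obtain ⟨ρ, hρ, hord⟩ := exists_isStringCGroupRep_of_diag (n := m + 6) (l := m + 4)
    (N := 2 * (m + 5) + 3) (by omega) (hm.add (by decide)) (by omega)
    (reducedSwap m) hord (reducedSwap_of_ne m (by omega)) hfix hcomm (reducedSep m)
    (copyFlip_mem_reducedSep m)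
    (fun j k => diag_reducedSwap_mem_reducedSep m) (fun E H σ => mem_of_reducedSep)
  refine ⟨ρ, hρ, fun i hi1 hi => (hord i hi1 hi).trans ?_⟩
  split_ifs with h1 h3 h4
  · rfl
  · subst h3
    rw [reducedSwap_self, reducedSwap_of_ne m (by omega)]
    exact orderOf_adjSwap_mul_doubleSwap m
  · subst h4
    rw [reducedSwap_of_ne m (j := m + 4) (by omega)]
    exact (congrArg (fun f => orderOf (f * _)) (reducedSwap_self m)).trans
      (orderOf_doubleSwap_mul_adjSwap m)
  · rw [reducedSwap_of_ne m (by omega), reducedSwap_of_ne m h3]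
    exact orderOf_adjSwap_mul_adjSwap (by omega) (by omega)

section

open scoped Pointwise

/-- Generators of `A₅` acting as the automorphism group of the hemi-dodecahedron. -/
def pentagonSwaps : Fin 3 → Perm (Fin 5) :=
  ![swap 1 3 * swap 2 4, swap 0 1 * swap 3 4, swap 1 2 * swap 3 4]

/-- The edges of a pentagon preserved by the first two elements of `pentagonSwaps`. -/
def pentagon : Finset (Finset (Fin 5)) := {{0, 3}, {3, 2}, {2, 4}, {4, 1}, {1, 0}}

theorem closure_pentagonSwaps :
    Subgroup.closure (Set.range pentagonSwaps) = alternatingGroup (Fin 5) := by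
  set G := Subgroup.closure (Set.range pentagonSwaps)
  have hG : ∀ i, pentagonSwaps i ∈ G := fun i => Subgroup.subset_closure ⟨i, rfl⟩
  refine le_antisymm ?_ ?_
  · rw [Subgroup.closure_le]
    rintro _ ⟨i, rfl⟩
    revert i
    simp only [SetLike.mem_coe, mem_alternatingGroup]
    decide
  have hz : pentagonSwaps 0 * pentagonSwaps 1 ∈ G := mul_mem (hG 0) (hG 1)
  have htrans : MulAction.IsPretransitive G (Fin 5) := by
    rw [MulAction.isPretransitive_iff_base 0]
    intro y
    obtain ⟨k, hk⟩ : ∃ k : Fin 5, ((pentagonSwaps 0 * pentagonSwaps 1) ^ k.val) 0 = y := by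
      revert y
      decide
    exact ⟨⟨_, pow_mem hz k.val⟩, hk⟩
  have hprim : MulAction.IsPreprimitive G (Fin 5) :=
    MulAction.IsPreprimitive.of_prime_card (by rw [Nat.card_fin]; norm_num)
  refine alternatingGroup_le_of_isPreprimitive_of_isThreeCycle_mem hprim
    (g := pentagonSwaps 1 * pentagonSwaps 2) ?_ (mul_mem (hG 1) (hG 2))
  have : pentagonSwaps 1 * pentagonSwaps 2 = swap 1 0 * swap 1 2 := by decide
  rw [this]
  exact isThreeCycle_swap_mul_swap_same (by decide) (by decide) (by decide)

/-- The elements of the subgroup generated by the last two elements of `pentagonSwaps`. -/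
def vertexGroup : List (Perm (Fin 5)) :=
  let a := pentagonSwaps 1
  let b := pentagonSwaps 2
  [1, a, b, a * b, b * a, a * b * a]

set_option maxRecDepth 100000 in
theorem mem_vertexGroup_of_mem_closure {g : Perm (Fin 5)}
    (hg : g ∈ Subgroup.closure (pentagonSwaps '' {0}ᶜ)) : g ∈ vertexGroup := by
  induction hg using Subgroup.closure_induction with
  | mem x hx =>
    obtain ⟨i, hi, rfl⟩ := hx
    revert i
    simp only [Set.mem_compl_iff, Set.mem_singleton_iff]
    decide
  | one => decide
  | mul x y _ _ hx hy =>
    have : ∀ x ∈ vertexGroup, ∀ y ∈ vertexGroup, x * y ∈ vertexGroup := by decide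
    exact this x hx y hy
  | inv x _ hx =>
    have : ∀ x ∈ vertexGroup, x⁻¹ ∈ vertexGroup := by decide
    exact this x hx

set_option maxRecDepth 100000 in
theorem exists_rep_rank_three :
    ∃ ρ : Fin 3 → alternatingGroup (Fin 5), IsStringCGroupRep ρ := by
  have hcomm : ∀ i j : Fin 3, i.val + 1 < j.val → Commute (pentagonSwaps i) (pentagonSwaps j) := by
    simp only [Commute, SemiconjBy]
    decide
  have hord : ∀ i, orderOf (pentagonSwaps i) = 2 := fun i => by
    refine orderOf_eq_prime ?_ ?_ <;> revert i <;> decide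
  have hint := intersection_property_of_separating hcomm
    ![⊤, MulAction.stabilizer (Perm (Fin 5)) (0 : Fin 5),
      MulAction.stabilizer (Perm (Fin 5)) pentagon] ?_ ?_
  · obtain ⟨ρ, hρ, -⟩ := exists_isStringCGroupRep_alternatingGroup (Equiv.refl (Fin 5)) hord
      closure_pentagonSwaps hcomm hint
    exact ⟨ρ, hρ⟩
  · intro j k hjk
    fin_cases k
    · exact Subgroup.mem_top _
    · change pentagonSwaps j • (0 : Fin 5) = 0
      revert j
      decide
    · change pentagonSwaps j • pentagon = pentagon
      revert j
      decide
  · intro J h0 g hg hQ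
    have hgL := mem_vertexGroup_of_mem_closure hg
    have hmem : ∀ i ∈ J, pentagonSwaps i ∈ Subgroup.closure (pentagonSwaps '' J) := fun i hi =>
      Subgroup.subset_closure ⟨i, hi, rfl⟩
    by_cases h1 : 1 ∈ J
    · by_cases h2 : 2 ∈ J
      · refine Subgroup.closure_mono (Set.image_mono fun i hi => ?_) hg
        fin_cases i
        exacts [absurd rfl hi, h1, h2]
      · have hg2 : g • pentagon = pentagon := hQ 2 h2 (by decide)
        have : ∀ g ∈ vertexGroup, g • pentagon = pentagon → g = 1 ∨ g = pentagonSwaps 1 := by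
          decide
        obtain rfl | rfl := this g hgL hg2
        exacts [one_mem _, hmem 1 h1]
    · have hg1 : g • (0 : Fin 5) = 0 := hQ 1 h1 (by decide)
      have hg0 : ∀ g ∈ vertexGroup, g • (0 : Fin 5) = 0 → g = 1 ∨ g = pentagonSwaps 2 := by
        decide
      obtain rfl | rfl := hg0 g hgL hg1
      · exact one_mem _
      · by_cases h2 : 2 ∈ J
        · exact hmem 2 h2
        · have hg2 : pentagonSwaps 2 • pentagon = pentagon := hQ 2 h2 (by decide)
          exact absurd hg2 (by decide)

end

end

/-- Rank-`r` string C-group representations for alternating groups: type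
`{10, 3^(r-2)}` on `A_(2r+1)` for even `r ≥ 4`, type `{10, 3^(q-4), 6, 4}` on
`A_(2q+3)` for odd `q ≥ 5`; in particular every rank `k ≥ 3` is realized by some
alternating group. -/
theorem alternatingGroup_all_ranks_schlafli :
    (∀ r : ℕ, 4 ≤ r → Even r →
      ∃ ρ : Fin r → alternatingGroup (Fin (2 * r + 1)), IsStringCGroupRep ρ ∧
        ∀ (i : ℕ) (hi1 : 1 ≤ i) (hir : i < r),
          orderOf (ρ ⟨i - 1, by omega⟩ * ρ ⟨i, hir⟩) = if i = 1 then 10 else 3) ∧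
    (∀ q : ℕ, 5 ≤ q → Odd q →
      ∃ ρ : Fin q → alternatingGroup (Fin (2 * q + 3)), IsStringCGroupRep ρ ∧
        ∀ (i : ℕ) (hi1 : 1 ≤ i) (hiq : i < q),
          orderOf (ρ ⟨i - 1, by omega⟩ * ρ ⟨i, hiq⟩) =
            if i = 1 then 10 else if i = q - 2 then 6 else if i = q - 1 then 4 else 3) ∧
    (∀ k : ℕ, 3 ≤ k →
      ∃ n : ℕ, ∃ ρ : Fin k → alternatingGroup (Fin n), IsStringCGroupRep ρ) := by
  have h10 : ∀ r : ℕ, 4 ≤ r → Even r →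
      ∃ ρ : Fin r → alternatingGroup (Fin (2 * r + 1)), IsStringCGroupRep ρ ∧
        ∀ (i : ℕ) (hi1 : 1 ≤ i) (hir : i < r),
          orderOf (ρ ⟨i - 1, by omega⟩ * ρ ⟨i, hir⟩) = if i = 1 then 10 else 3 := by
    intro r hr hev
    obtain ⟨l, rfl⟩ : ∃ l, r = l + 1 := ⟨r - 1, by omega⟩
    exact exists_rep_ten_threes l hev hr
  have h64 : ∀ q : ℕ, 5 ≤ q → Odd q →
      ∃ ρ : Fin q → alternatingGroup (Fin (2 * q + 3)), IsStringCGroupRep ρ ∧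
        ∀ (i : ℕ) (hi1 : 1 ≤ i) (hiq : i < q),
          orderOf (ρ ⟨i - 1, by omega⟩ * ρ ⟨i, hiq⟩) =
            if i = 1 then 10 else if i = q - 2 then 6 else if i = q - 1 then 4 else 3 := by
    intro q hq hodd
    obtain ⟨m, rfl⟩ : ∃ m, q = m + 5 := ⟨q - 5, by omega⟩
    exact exists_rep_ten_threes_six_four m (by grind)
  refine ⟨h10, h64, fun k hk => ?_⟩
  obtain hev | hodd := Nat.even_or_odd k
  · obtain ⟨ρ, hρ, -⟩ := h10 k (by grind) hev
    exact ⟨_, ρ, hρ⟩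
  · obtain rfl | h5 : k = 3 ∨ 5 ≤ k := by grind
    · exact ⟨5, exists_rep_rank_three⟩
    · obtain ⟨ρ, hρ, -⟩ := h64 k h5 hodd
      exact ⟨_, ρ, hρ⟩
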